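/- arXiv:1312.0850 — 2 statements merged into one kernel-verified Lean document; each statement's English description precedes it below -/
import Mathlib

section
/- Let 𝒳 = ℝ^d with the Euclidean metric and Lebesgue measure ℒ, and let V be the volume of the d-dimensional unit ball. Let 0 ≤ λ ≤ 1/(eV) and let α ∈ [0, 1/V] satisfy λ = α·exp(−αV). Then Z(B, λℒ) > 0 for every bounded Borel set B ⊆ ℝ^d, and for all bounded Borel sets A, B one has Z(A ∪ B, λℒ)/Z(B, λℒ) ≥ exp(−α ℒ(A \ B)) > 0. -/
open MeasureTheory Metric

/-- Indicator of 1-hard-core tuples: `1` iff all pairs of distinct coordinates are at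
distance at least one. (`h_0 = 1` by the empty quantification.) -/
noncomputable def hardCore {X : Type*} [MetricSpace X] (n : ℕ) (x : Fin n → X) : ℝ :=
  if ∀ i j : Fin n, i ≠ j → 1 ≤ dist (x i) (x j) then 1 else 0

/-- The generating function `Z(B, M)` of weighted 1-hard-core configurations. -/
noncomputable def genZ {X : Type*} [MetricSpace X] [MeasurableSpace X]
    (B : Set X) (M : Measure X) : ℝ :=
  ∑' n : ℕ, ((-1 : ℝ) ^ n / n.factorial) *
    ∫ x in (Set.univ.pi fun _ : Fin n => B), hardCore n x ∂(Measure.pi fun _ : Fin n => M)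

/-- The unit partition number `κ(B)`: the least `k` such that `B` is a disjoint union of
`k` Borel sets of diameter less than one (`⊤` if there is no such finite partition). -/
noncomputable def kappa {X : Type*} [MetricSpace X] [MeasurableSpace X] (B : Set X) : ℕ∞ :=
  sInf {k : ℕ∞ | ∃ m : ℕ, k = (m : ℕ∞) ∧ ∃ A : Fin m → Set X,
    (∀ i, MeasurableSet (A i)) ∧ (∀ i, EMetric.diam (A i) < 1) ∧
    Pairwise (Function.onFun Disjoint A) ∧ B = ⋃ i, A i}

section GeneratingFunction

variable {X : Type*} [MetricSpace X] {A B C : Set X}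

theorem hardCore_nonneg (n : ℕ) (x : Fin n → X) : 0 ≤ hardCore n x := by
  unfold hardCore; split_ifs <;> norm_num

theorem hardCore_le_one (n : ℕ) (x : Fin n → X) : hardCore n x ≤ 1 := by
  unfold hardCore; split_ifs <;> norm_num

theorem norm_hardCore_le_one (n : ℕ) (x : Fin n → X) : ‖hardCore n x‖ ≤ 1 := by
  rw [Real.norm_of_nonneg (hardCore_nonneg n x)]
  exact hardCore_le_one n x

theorem hardCore_insertNth {n : ℕ} (i : Fin (n + 1)) (x : X) (y : Fin n → X) :
    hardCore (n + 1) (i.insertNth (α := fun _ => X) x y) =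
      (Set.univ.pi fun _ : Fin n => (ball x 1)ᶜ).indicator (hardCore n) y := by
  have key : (∀ j k : Fin (n + 1), j ≠ k →
      1 ≤ dist (i.insertNth (α := fun _ => X) x y j) (i.insertNth (α := fun _ => X) x y k)) ↔
      (y ∈ Set.univ.pi fun _ : Fin n => (ball x 1)ᶜ) ∧
        ∀ j k : Fin n, j ≠ k → 1 ≤ dist (y j) (y k) := by
    simp only [Fin.forall_iff_succAbove i, Fin.insertNth_apply_same,
      Fin.insertNth_apply_succAbove, Set.mem_univ_pi, Set.mem_compl_iff, mem_ball, not_lt,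
      ne_eq, not_true_eq_false, false_imp_iff, true_and, Fin.succAbove_ne, Fin.ne_succAbove,
      not_false_eq_true, true_imp_iff, Fin.succAbove_right_inj]
    constructor
    · rintro ⟨h1, h2⟩
      exact ⟨fun j => (h2 j).1, fun j k => (h2 j).2 k⟩
    · rintro ⟨h1, h2⟩
      exact ⟨fun j => dist_comm x (y j) ▸ h1 j, fun j => ⟨h1 j, h2 j⟩⟩
  unfold hardCore Set.indicator
  simp only [key]
  split_ifs <;> tauto

theorem indicator_hardCore_union {n : ℕ} (hA : ∀ x ∈ A, ∀ y ∈ A, dist x y < 1)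
    (hAC : Disjoint A C) (x : Fin n → X) :
    (Set.univ.pi fun _ : Fin n => C ∪ A).indicator (hardCore n) x =
      (Set.univ.pi fun _ : Fin n => C).indicator (hardCore n) x +
        ∑ i, (Set.univ.pi (Function.update (fun _ : Fin n => C) i A)).indicator
          (hardCore n) x := by
  by_cases hx : ∀ i j : Fin n, i ≠ j → 1 ≤ dist (x i) (x j)
  swap
  · have h0 : hardCore n x = 0 := by simp only [hardCore, if_neg hx]
    have hz : ∀ S : Set (Fin n → X), S.indicator (hardCore n) x = 0 := fun S =>
      Set.indicator_apply_eq_zero.2 fun _ => h0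
    simp only [hz, Finset.sum_const_zero, add_zero]
  by_cases hC : ∀ i, x i ∈ C
  · rw [Set.indicator_of_mem (s := Set.univ.pi fun _ : Fin n => C ∪ A)
      (Set.mem_univ_pi.2 fun i => Or.inl (hC i)),
      Set.indicator_of_mem (Set.mem_univ_pi.2 hC), Finset.sum_eq_zero, add_zero]
    intro i _
    refine Set.indicator_of_notMem (fun h => ?_) _
    have := Set.mem_univ_pi.1 h i
    rw [Function.update_self] at this
    exact Set.disjoint_left.1 hAC this (hC i)
  rw [Set.indicator_of_notMem (s := Set.univ.pi fun _ : Fin n => C)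
    (fun h => hC (Set.mem_univ_pi.1 h)), zero_add]
  by_cases hCA : ∀ i, x i ∈ C ∪ A
  · push Not at hC
    obtain ⟨i, hi⟩ := hC
    have hiA : x i ∈ A := (hCA i).resolve_left hi
    rw [Set.indicator_of_mem (Set.mem_univ_pi.2 hCA), Finset.sum_eq_single i,
      Set.indicator_of_mem]
    · refine Set.mem_univ_pi.2 fun j => ?_
      rcases eq_or_ne j i with rfl | hj
      · rwa [Function.update_self]
      · rw [Function.update_of_ne hj]
        exact (hCA j).resolve_right fun h => (hA _ h _ hiA).not_ge (hx j i hj)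
    · intro j _ hj
      refine Set.indicator_of_notMem (fun h => hi ?_) _
      have := Set.mem_univ_pi.1 h i
      rwa [Function.update_of_ne hj.symm] at this
    · simp
  · rw [Set.indicator_of_notMem (fun h => hCA (Set.mem_univ_pi.1 h)), Finset.sum_eq_zero]
    intro i _
    refine Set.indicator_of_notMem (fun h => hCA fun j => ?_) _
    have := Set.mem_univ_pi.1 h j
    rcases eq_or_ne j i with rfl | hj
    · rw [Function.update_self] at this
      exact Or.inr this
    · rw [Function.update_of_ne hj] at this
      exact Or.inl this

variable [MeasurableSpace X] {M : Measure X}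

/-- The integral of the `n`-point hard-core indicator over `B^n`. -/
noncomputable def hardCoreIntegral (n : ℕ) (B : Set X) (M : Measure X) : ℝ :=
  ∫ x in (Set.univ.pi fun _ : Fin n => B), hardCore n x ∂(Measure.pi fun _ : Fin n => M)

theorem hardCoreIntegral_zero : hardCoreIntegral 0 B M = 1 := by
  simp [hardCoreIntegral, hardCore, Measure.real]

theorem hardCoreIntegral_empty {n : ℕ} (hn : n ≠ 0) : hardCoreIntegral n (∅ : Set X) M = 0 := by
  have : Nonempty (Fin n) := Fin.pos_iff_nonempty.1 (Nat.pos_of_ne_zero hn)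
  simp [hardCoreIntegral, Set.univ_pi_empty]

theorem genZ_empty : genZ (∅ : Set X) M = 1 := by
  change ∑' n : ℕ, ((-1 : ℝ) ^ n / n.factorial) * hardCoreIntegral n ∅ M = 1
  rw [tsum_eq_single 0 fun n hn => by rw [hardCoreIntegral_empty hn, mul_zero],
    hardCoreIntegral_zero]
  simp

section SigmaFinite

variable [SigmaFinite M]

theorem norm_hardCoreIntegral_le (n : ℕ) (hB : M B ≠ ⊤) :
    ‖hardCoreIntegral n B M‖ ≤ M.real B ^ n := by
  have hpi : (Measure.pi fun _ : Fin n => M) (Set.univ.pi fun _ => B) = M B ^ n := by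
    simp [Measure.pi_pi]
  refine (norm_setIntegral_le_of_norm_le_const (C := 1) ?_
    fun x _ => norm_hardCore_le_one n x).trans_eq ?_
  · rw [hpi]
    exact ENNReal.pow_lt_top hB.lt_top
  · simp [Measure.real, hpi]

theorem norm_genZ_term_le (n : ℕ) (hB : M B ≠ ⊤) :
    ‖((-1 : ℝ) ^ n / n.factorial) * hardCoreIntegral n B M‖ ≤ M.real B ^ n / n.factorial := by
  rw [norm_mul, norm_div, norm_pow, norm_neg, norm_one, one_pow, Real.norm_natCast,
    div_mul_eq_mul_div, one_mul]
  gcongr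
  exact norm_hardCoreIntegral_le n hB

theorem hasSum_genZ (hB : M B ≠ ⊤) :
    HasSum (fun n : ℕ => ((-1 : ℝ) ^ n / n.factorial) * hardCoreIntegral n B M) (genZ B M) :=
  (Summable.of_norm_bounded (Real.summable_pow_div_factorial (M.real B))
    fun n => norm_genZ_term_le n hB).hasSum

end SigmaFinite

variable [BorelSpace X]

theorem setIntegral_hardCore_insertNth {n : ℕ} (i : Fin (n + 1)) (x : X) :
    ∫ y in (Set.univ.pi fun _ : Fin n => C),
      hardCore (n + 1) (i.insertNth (α := fun _ => X) x y) ∂(Measure.pi fun _ : Fin n => M) =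
      hardCoreIntegral n (C \ ball x 1) M := by
  simp only [hardCore_insertNth]
  rw [setIntegral_indicator (MeasurableSet.univ_pi fun _ => measurableSet_ball.compl),
    ← Set.pi_inter_distrib]
  rfl

variable [SecondCountableTopology X]

theorem measurable_hardCore (n : ℕ) : Measurable (hardCore (X := X) n) := by
  refine Measurable.ite ?_ measurable_const measurable_const
  simp only [Set.ofPred_forall]
  refine MeasurableSet.iInter fun i => MeasurableSet.iInter fun j => MeasurableSet.iInter fun _ => ?_
  exact measurableSet_le measurable_const
    ((measurable_pi_apply i).dist (measurable_pi_apply j))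

theorem integrableOn_hardCore (n : ℕ) {S : Set (Fin n → X)}
    (hS : (Measure.pi fun _ : Fin n => M) S ≠ ⊤) :
    IntegrableOn (hardCore n) S (Measure.pi fun _ : Fin n => M) :=
  Measure.integrableOn_of_bounded (M := 1) hS (measurable_hardCore n).aestronglyMeasurable
    (Filter.Eventually.of_forall fun x => norm_hardCore_le_one n x)

variable [SigmaFinite M]

theorem integrableOn_hardCore_insertNth {n : ℕ} (i : Fin (n + 1)) (hA : M A ≠ ⊤) (hC : M C ≠ ⊤) :
    IntegrableOn
      (fun p : X × (Fin n → X) => hardCore (n + 1) (i.insertNth (α := fun _ => X) p.1 p.2))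
      (A ×ˢ Set.univ.pi fun _ => C) (M.prod (Measure.pi fun _ : Fin n => M)) := by
  refine Measure.integrableOn_of_bounded (M := 1) ?_ ?_
    (Filter.Eventually.of_forall fun p => norm_hardCore_le_one _ _)
  · rw [Measure.prod_prod, Measure.pi_pi, Finset.prod_const]
    exact ENNReal.mul_ne_top hA (ENNReal.pow_ne_top hC)
  · exact ((measurable_hardCore (n + 1)).comp
      (MeasurableEquiv.piFinSuccAbove (fun _ => X) i).symm.measurable).aestronglyMeasurable

theorem integrableOn_hardCoreIntegral_diff_ball (n : ℕ) (hA : M A ≠ ⊤) (hC : M C ≠ ⊤) :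
    IntegrableOn (fun x => hardCoreIntegral n (C \ ball x 1) M) A M := by
  have h := integrableOn_hardCore_insertNth (0 : Fin (n + 1)) hA hC
  rw [IntegrableOn, ← Measure.prod_restrict] at h
  simpa only [setIntegral_hardCore_insertNth] using! h.integral_prod_left

theorem setIntegral_hardCore_update {n : ℕ} (i : Fin (n + 1)) (hA : M A ≠ ⊤) (hC : M C ≠ ⊤) :
    ∫ x in Set.univ.pi (Function.update (fun _ : Fin (n + 1) => C) i A), hardCore (n + 1) x
        ∂(Measure.pi fun _ : Fin (n + 1) => M) =
      ∫ x in A, hardCoreIntegral n (C \ ball x 1) M ∂M := by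
  have hset : Set.univ.pi (Function.update (fun _ : Fin (n + 1) => C) i A) =
      MeasurableEquiv.piFinSuccAbove (fun _ => X) i ⁻¹' (A ×ˢ Set.univ.pi fun _ => C) := by
    ext x
    simp [Fin.forall_iff_succAbove i, MeasurableEquiv.piFinSuccAbove, Fin.insertNthEquiv,
      Fin.removeNth, Fin.succAbove_ne]
  have hfun : hardCore (X := X) (n + 1) = fun x =>
      (fun p : X × (Fin n → X) => hardCore (n + 1) (i.insertNth (α := fun _ => X) p.1 p.2))
        (MeasurableEquiv.piFinSuccAbove (fun _ => X) i x) := by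
    funext x
    congr 1
    exact ((MeasurableEquiv.piFinSuccAbove (fun _ => X) i).symm_apply_apply x).symm
  rw [hset, hfun, (measurePreserving_piFinSuccAbove (fun _ => M) i).setIntegral_preimage_emb
    (MeasurableEquiv.measurableEmbedding _), setIntegral_prod _
    (integrableOn_hardCore_insertNth i hA hC)]
  simp only [setIntegral_hardCore_insertNth]

theorem hardCoreIntegral_succ_union (n : ℕ) (hAm : MeasurableSet A) (hCm : MeasurableSet C)
    (hA : M A ≠ ⊤) (hC : M C ≠ ⊤) (hdist : ∀ x ∈ A, ∀ y ∈ A, dist x y < 1)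
    (hAC : Disjoint A C) :
    hardCoreIntegral (n + 1) (C ∪ A) M = hardCoreIntegral (n + 1) C M +
      (n + 1) * ∫ x in A, hardCoreIntegral n (C \ ball x 1) M ∂M := by
  have hm : ∀ i, MeasurableSet
      (Set.univ.pi (Function.update (fun _ : Fin (n + 1) => C) i A)) := fun i =>
    MeasurableSet.univ_pi fun j => by
      rcases eq_or_ne j i with rfl | hj
      · rwa [Function.update_self]
      · rwa [Function.update_of_ne hj]
  have hfin : ∀ i, (Measure.pi fun _ : Fin (n + 1) => M)
      (Set.univ.pi (Function.update (fun _ : Fin (n + 1) => C) i A)) ≠ ⊤ := fun i => by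
    rw [Measure.pi_pi]
    refine ENNReal.prod_ne_top fun j _ => ?_
    rcases eq_or_ne j i with rfl | hj
    · rwa [Function.update_self]
    · rwa [Function.update_of_ne hj]
  have hfinC : (Measure.pi fun _ : Fin (n + 1) => M) (Set.univ.pi fun _ => C) ≠ ⊤ := by
    rw [Measure.pi_pi]
    exact ENNReal.prod_ne_top fun j _ => hC
  have hmC : MeasurableSet (Set.univ.pi fun _ : Fin (n + 1) => C) :=
    MeasurableSet.univ_pi fun _ => hCm
  rw [hardCoreIntegral, ← integral_indicator (MeasurableSet.univ_pi fun _ => hCm.union hAm)]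
  simp only [indicator_hardCore_union hdist hAC]
  rw [integral_add ((integrable_indicator_iff hmC).2 (integrableOn_hardCore _ hfinC))
    (integrable_finsetSum _ fun i _ =>
      (integrable_indicator_iff (hm i)).2 (integrableOn_hardCore _ (hfin i))),
    integral_finsetSum _ fun i _ =>
      (integrable_indicator_iff (hm i)).2 (integrableOn_hardCore _ (hfin i)),
    integral_indicator hmC]
  simp only [integral_indicator (hm _), setIntegral_hardCore_update _ hA hC]
  simp [hardCoreIntegral]

/-- Adding to `C` a set `A` that carries at most one point of any hard-core configuration. -/
theorem genZ_union (hAm : MeasurableSet A) (hCm : MeasurableSet C)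
    (hA : M A ≠ ⊤) (hC : M C ≠ ⊤) (hdist : ∀ x ∈ A, ∀ y ∈ A, dist x y < 1)
    (hAC : Disjoint A C) :
    genZ (C ∪ A) M = genZ C M - ∫ x in A, genZ (C \ ball x 1) M ∂M := by
  have hU : M (C ∪ A) ≠ ⊤ := measure_union_ne_top hC hA
  have hD : ∀ x, M (C \ ball x 1) ≠ ⊤ := fun x => measure_ne_top_of_subset Set.sdiff_subset hC
  have hint : HasSum (fun n : ℕ => ∫ x in A, ((-1 : ℝ) ^ n / n.factorial) *
      hardCoreIntegral n (C \ ball x 1) M ∂M) (∫ x in A, genZ (C \ ball x 1) M ∂M) := by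
    refine hasSum_integral_of_summable_integral_norm (fun n =>
      (integrableOn_hardCoreIntegral_diff_ball n hA hC).const_mul _) ?_
    refine Summable.of_nonneg_of_le (fun n => integral_nonneg fun x => norm_nonneg _) (fun n => ?_)
      ((Real.summable_pow_div_factorial (M.real C)).mul_right (M.real A))
    refine (le_abs_self _).trans ?_
    rw [← Real.norm_eq_abs]
    refine norm_setIntegral_le_of_norm_le_const hA.lt_top fun x _ => ?_
    rw [norm_norm]
    refine (norm_genZ_term_le n (hD x)).trans ?_
    gcongr
    exact Set.sdiff_subset
  have h1 := (hasSum_nat_add_iff' 1).2 (hasSum_genZ (M := M) hU)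
  have h2 := ((hasSum_nat_add_iff' 1).2 (hasSum_genZ (M := M) hC)).sub hint
  have := h1.unique (h2.congr_fun ?_)
  · simp [hardCoreIntegral_zero] at this
    linarith
  · intro n
    rw [hardCoreIntegral_succ_union n hAm hCm hA hC hdist hAC, integral_const_mul,
      Nat.factorial_succ]
    push_cast
    field_simp
    ring

theorem genZ_union_ge {β v : ℝ} (hβ : Real.exp (β * v) ≤ β) (hAm : MeasurableSet A)
    (hCm : MeasurableSet C) (hA : M A ≠ ⊤) (hC : M C ≠ ⊤)
    (hdist : ∀ x ∈ A, ∀ y ∈ A, dist x y < 1) (hAC : Disjoint A C) (hZ : 0 ≤ genZ C M)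
    (hpos : ∀ x ∈ A, 0 ≤ genZ (C \ ball x 1) M)
    (hle : ∀ x ∈ A, genZ (C \ ball x 1) M ≤ Real.exp (β * (v - M.real A)) * genZ C M) :
    Real.exp (-(β * M.real A)) * genZ C M ≤ genZ (C ∪ A) M := by
  have hint : ∫ x in A, genZ (C \ ball x 1) M ∂M ≤
      Real.exp (β * (v - M.real A)) * genZ C M * M.real A :=
    (le_abs_self _).trans (norm_setIntegral_le_of_norm_le_const hA.lt_top fun x hx => by
      rw [Real.norm_of_nonneg (hpos x hx)]
      exact hle x hx)
  rw [genZ_union hAm hCm hA hC hdist hAC]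
  have hm : 0 ≤ M.real A := measureReal_nonneg
  set t := β * M.real A with ht
  have hexp : Real.exp (β * (v - M.real A)) * M.real A ≤ t * Real.exp (-t) := by
    have : β * (v - M.real A) = β * v + -t := by rw [ht]; ring
    rw [this, Real.exp_add, ht, mul_right_comm]
    gcongr
  have hone : (t + 1) * Real.exp (-t) ≤ 1 := by
    calc (t + 1) * Real.exp (-t) ≤ Real.exp t * Real.exp (-t) := by
          gcongr
          exact Real.add_one_le_exp t
      _ = 1 := by rw [← Real.exp_add, add_neg_cancel, Real.exp_zero]
  nlinarith [mul_le_mul_of_nonneg_right hexp hZ, mul_le_mul_of_nonneg_right hone hZ]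

variable {ι : Type*} [DecidableEq ι] {D : ι → Set X}

/-- The Lovász-local-lemma type induction over a finite cover by sets of diameter less than
one. -/
theorem genZ_pos_and_ratio_of_subset_biUnion {β v : ℝ} (hβ : Real.exp (β * v) ≤ β)
    (hfin : ∀ x, M (ball x 1) ≠ ⊤) (hv : ∀ x, M.real (ball x 1) ≤ v)
    (hDm : ∀ i, MeasurableSet (D i)) (hD : ∀ i, ∀ x ∈ D i, ∀ y ∈ D i, dist x y < 1)
    (s : Finset ι) :
    ∀ C : Set X, MeasurableSet C → M C ≠ ⊤ → C ⊆ ⋃ i ∈ s, D i →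
      0 < genZ C M ∧ ∀ B ⊆ C, MeasurableSet B →
        Real.exp (-(β * M.real (C \ B))) * genZ B M ≤ genZ C M := by
  have hβ0 : 0 ≤ β := (Real.exp_pos _).le.trans hβ
  induction s using Finset.strongInduction with
  | H s ih =>
  have main : ∀ i ∈ s, ∀ C : Set X, MeasurableSet C → M C ≠ ⊤ → C ⊆ ⋃ i ∈ s, D i →
      0 < genZ C M ∧ ∀ A ⊆ D i, MeasurableSet A → M A ≠ ⊤ → Disjoint A C →
        Real.exp (-(β * M.real A)) * genZ C M ≤ genZ (C ∪ A) M := by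
    intro i hi C hCm hC hCs
    have hE : C \ D i ⊆ ⋃ j ∈ s.erase i, D j := by
      rintro x ⟨hxC, hxD⟩
      obtain ⟨j, hj, hxj⟩ := Set.mem_iUnion₂.1 (hCs hxC)
      exact Set.mem_iUnion₂.2 ⟨j, Finset.mem_erase.2 ⟨fun h => hxD (h ▸ hxj), hj⟩, hxj⟩
    have hEm : MeasurableSet (C \ D i) := hCm.diff (hDm i)
    have hEfin : M (C \ D i) ≠ ⊤ := measure_ne_top_of_subset Set.sdiff_subset hC
    have hGm : MeasurableSet (C ∩ D i) := hCm.inter (hDm i)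
    have hGfin : M (C ∩ D i) ≠ ⊤ := measure_ne_top_of_subset Set.inter_subset_left hC
    have ihE := ih _ (Finset.erase_ssubset hi)
    obtain ⟨hEpos, hEratio⟩ := ihE _ hEm hEfin hE
    have hsub : ∀ x ∈ D i, D i ⊆ ball x 1 := fun x hx y hy => hD i y hy x hx
    have hball : ∀ x ∈ D i, 0 < genZ ((C \ D i) \ ball x 1) M ∧
        genZ ((C \ D i) \ ball x 1) M ≤
          Real.exp (β * M.real ((C \ D i) ∩ ball x 1)) * genZ (C \ D i) M := by
      intro x _
      have hm := hEm.diff (measurableSet_ball (x := x) (ε := 1))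
      refine ⟨(ihE _ hm (measure_ne_top_of_subset Set.sdiff_subset hEfin)
        (Set.sdiff_subset.trans hE)).1, ?_⟩
      have h := hEratio _ (Set.sdiff_subset (t := ball x 1)) hm
      rw [Set.sdiff_sdiff_right_self, Real.exp_neg, inv_mul_le_iff₀ (Real.exp_pos _)] at h
      exact h
    have hunion : (C \ D i) ∪ (C ∩ D i) = C := Set.sdiff_union_inter C (D i)
    have hEG : Real.exp (-(β * M.real (C ∩ D i))) * genZ (C \ D i) M ≤ genZ C M := by
      conv_rhs => rw [← hunion]
      refine genZ_union_ge hβ hGm hEm hGfin hEfin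
        (fun x hx y hy => hD i x hx.2 y hy.2)
        (Set.disjoint_left.2 fun x hx hx' => hx'.2 hx.2) hEpos.le
        (fun x hx => (hball x hx.2).1.le) fun x hx => (hball x hx.2).2.trans ?_
      have hdisj : Disjoint ((C \ D i) ∩ ball x 1) (C ∩ D i) :=
        Set.disjoint_left.2 fun y hy hy' => hy.1.2 hy'.2
      have hmeas := measureReal_union (μ := M) hdisj hGm
        (measure_ne_top_of_subset Set.inter_subset_left hEfin) hGfin
      have hmono := measureReal_mono (μ := M) (Set.union_subset
        (Set.inter_subset_right (s := C \ D i) (t := ball x 1))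
        (Set.inter_subset_right.trans (hsub x hx.2) : C ∩ D i ⊆ ball x 1)) (hfin x)
      have := hv x
      gcongr
      linarith
    have hCpos : 0 < genZ C M := (mul_pos (Real.exp_pos _) hEpos).trans_le hEG
    refine ⟨hCpos, fun A hAD hAm hA hAC => ?_⟩
    have hdiff : ∀ x ∈ D i, C \ ball x 1 = (C \ D i) \ ball x 1 := fun x hx => by
      ext y
      have := @hsub x hx y
      simp only [Set.mem_sdiff]
      tauto
    refine genZ_union_ge hβ hAm hCm hA hC (fun x hx y hy => hD i x (hAD hx) y (hAD hy)) hAC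
      hCpos.le (fun x hx => ?_) fun x hx => ?_
    · rw [hdiff x (hAD hx)]
      exact (hball x (hAD hx)).1.le
    rw [hdiff x (hAD hx)]
    rw [Real.exp_neg, inv_mul_le_iff₀ (Real.exp_pos _)] at hEG
    have hdisj : Disjoint ((C \ D i) ∩ ball x 1) (C ∩ D i) :=
      Set.disjoint_left.2 fun y hy hy' => hy.1.2 hy'.2
    have hdisj' : Disjoint (((C \ D i) ∩ ball x 1) ∪ (C ∩ D i)) A :=
      Set.disjoint_left.2 fun y hy hy' => Set.disjoint_left.1 hAC hy'
        (hy.elim (fun h => h.1.1) fun h => h.1)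
    have hIfin : M ((C \ D i) ∩ ball x 1) ≠ ⊤ :=
      measure_ne_top_of_subset Set.inter_subset_left hEfin
    have hmeas := measureReal_union (μ := M) hdisj hGm hIfin hGfin
    have hmeas' := measureReal_union (μ := M) hdisj' hAm (measure_union_ne_top hIfin hGfin) hA
    have hmono := measureReal_mono (μ := M) (Set.union_subset (Set.union_subset
        (Set.inter_subset_right (s := C \ D i) (t := ball x 1))
        (Set.inter_subset_right.trans (hsub x (hAD hx)) : C ∩ D i ⊆ ball x 1))
        (hAD.trans (hsub x (hAD hx)))) (hfin x)
    have hvx := hv x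
    calc genZ ((C \ D i) \ ball x 1) M
        ≤ Real.exp (β * M.real ((C \ D i) ∩ ball x 1)) *
          (Real.exp (β * M.real (C ∩ D i)) * genZ C M) :=
          (hball x (hAD hx)).2.trans (by gcongr)
      _ = Real.exp (β * (M.real ((C \ D i) ∩ ball x 1) + M.real (C ∩ D i))) * genZ C M := by
          rw [mul_add, Real.exp_add, mul_assoc]
      _ ≤ Real.exp (β * (v - M.real A)) * genZ C M := by
          gcongr
          linarith
  intro C hCm hC hCs
  refine ⟨?_, fun B hBC hBm => ?_⟩
  · rcases s.eq_empty_or_nonempty with rfl | ⟨i, hi⟩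
    · have : C = ∅ := by simpa using hCs
      rw [this, genZ_empty]
      exact one_pos
    · exact (main i hi C hCm hC hCs).1
  have hFm : MeasurableSet (C \ B) := hCm.diff hBm
  have chain : ∀ t ⊆ s, Real.exp (-(β * M.real ((C \ B) ∩ ⋃ i ∈ t, D i))) * genZ B M ≤
      genZ (B ∪ ((C \ B) ∩ ⋃ i ∈ t, D i)) M := by
    intro t
    induction t using Finset.induction_on with
    | empty => simp
    | insert i t _ iht =>
      intro hts
      have hT : MeasurableSet (⋃ j ∈ t, D j) := t.measurableSet_biUnion fun j _ => hDm j
      set T := ⋃ j ∈ t, D j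
      have hsplit : (C \ B) ∩ ⋃ j ∈ insert i t, D j =
          ((C \ B) ∩ T) ∪ (((C \ B) ∩ D i) \ T) := by
        rw [Finset.set_biUnion_insert]
        ext x
        simp only [Set.mem_inter_iff, Set.mem_union, Set.mem_sdiff, T]
        tauto
      have hAm : MeasurableSet (((C \ B) ∩ D i) \ T) := (hFm.inter (hDm i)).diff hT
      have hAsub : ((C \ B) ∩ D i) \ T ⊆ C := fun x hx => hx.1.1.1
      have hA := measure_ne_top_of_subset hAsub hC
      have hC'sub : B ∪ ((C \ B) ∩ T) ⊆ C := Set.union_subset hBC fun x hx => hx.1.1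
      have hC' := measure_ne_top_of_subset hC'sub hC
      have hstep := (main i (hts (Finset.mem_insert_self i t)) _ (hBm.union (hFm.inter hT)) hC'
        (hC'sub.trans hCs)).2 _ (fun x hx => hx.1.2) hAm hA
        (Set.disjoint_left.2 fun x hx hx' => hx'.elim hx.1.1.2 fun h => hx.2 h.2)
      rw [hsplit, ← Set.union_assoc, measureReal_union
        (Set.disjoint_left.2 fun x hx hx' => hx'.2 hx.2) hAm
        (measure_ne_top_of_subset (fun x hx => hx.1.1) hC) hA]
      refine le_trans ?_ hstep
      have := iht ((Finset.subset_insert i t).trans hts)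
      calc _ = Real.exp (-(β * M.real (((C \ B) ∩ D i) \ T))) *
            (Real.exp (-(β * M.real ((C \ B) ∩ T))) * genZ B M) := by
            rw [← mul_assoc, ← Real.exp_add]
            ring_nf
        _ ≤ _ := by gcongr
  have h := chain s subset_rfl
  rwa [Set.inter_eq_left.2 (Set.sdiff_subset.trans hCs), Set.union_sdiff_cancel hBC] at h

/-- Positivity and ratio bound for totally bounded sets, when `exp (β v) ≤ β` for an upper bound
`v` on the measure of unit balls. -/
theorem genZ_pos_and_ratio {β v : ℝ} (hβ : Real.exp (β * v) ≤ β)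
    (hfin : ∀ x, M (ball x 1) ≠ ⊤) (hv : ∀ x, M.real (ball x 1) ≤ v)
    (hCm : MeasurableSet C) (hC : M C ≠ ⊤) (hCb : TotallyBounded C) :
    0 < genZ C M ∧ ∀ B ⊆ C, MeasurableSet B →
      Real.exp (-(β * M.real (C \ B))) * genZ B M ≤ genZ C M := by
  classical
  obtain ⟨t, ht, hCt⟩ := Metric.totallyBounded_iff.1 hCb (1 / 2) (by norm_num)
  refine genZ_pos_and_ratio_of_subset_biUnion (D := fun y => ball y (1 / 2)) hβ hfin hv
    (fun _ => measurableSet_ball) (fun i x hx y hy => ?_) ht.toFinset C hCm hC (by simpa using hCt)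
  have := dist_triangle_right x y i
  rw [mem_ball] at hx hy
  linarith

end GeneratingFunction

/-- On `ℝ^d` with Lebesgue measure `ℒ` and `V` the volume of the unit ball: if
`0 ≤ λ ≤ 1/(eV)` and `α ∈ [0, 1/V]` satisfies `λ = α exp(−αV)`, then `Z(B, λℒ) > 0`
for every bounded Borel set `B`, and
`Z(A ∪ B, λℒ)/Z(B, λℒ) ≥ exp(−α ℒ(A \ B)) > 0`. -/
theorem stmt14 (d : ℕ) (lam α : ℝ)
    (V : ℝ) (hV : V = (volume (Metric.ball (0 : EuclideanSpace ℝ (Fin d)) 1)).toReal)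
    (hlam0 : 0 ≤ lam) (hlam : lam ≤ 1 / (Real.exp 1 * V))
    (hα0 : 0 ≤ α) (hα1 : α ≤ 1 / V)
    (heq : lam = α * Real.exp (-(α * V))) :
    (∀ B : Set (EuclideanSpace ℝ (Fin d)), MeasurableSet B → Bornology.IsBounded B →
      0 < genZ B (ENNReal.ofReal lam • volume)) ∧
    (∀ A B : Set (EuclideanSpace ℝ (Fin d)), MeasurableSet A → MeasurableSet B →
      Bornology.IsBounded A → Bornology.IsBounded B →
      Real.exp (-(α * (volume (A \ B)).toReal)) ≤
        genZ (A ∪ B) (ENNReal.ofReal lam • volume) /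
          genZ B (ENNReal.ofReal lam • volume) ∧
      0 < Real.exp (-(α * (volume (A \ B)).toReal))) := by
  have hσ : SigmaFinite
      (ENNReal.ofReal lam • (volume : Measure (EuclideanSpace ℝ (Fin d)))) :=
    inferInstanceAs (SigmaFinite (lam.toNNReal • volume))
  have hreal : ∀ S : Set (EuclideanSpace ℝ (Fin d)),
      (ENNReal.ofReal lam • volume : Measure (EuclideanSpace ℝ (Fin d))).real S =
        lam * (volume S).toReal := fun S => by simp [hlam0, Measure.real]
  have hfinite : ∀ S : Set (EuclideanSpace ℝ (Fin d)), Bornology.IsBounded S →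
      (ENNReal.ofReal lam • volume : Measure (EuclideanSpace ℝ (Fin d))) S ≠ ⊤ := fun S hS => by
    rw [Measure.smul_apply, smul_eq_mul]
    exact ENNReal.mul_ne_top ENNReal.ofReal_ne_top hS.measure_lt_top.ne
  have hβlam : Real.exp (α * V) * lam = α := by
    rw [heq, mul_left_comm, ← Real.exp_add, add_neg_cancel, Real.exp_zero, mul_one]
  have key : ∀ C : Set (EuclideanSpace ℝ (Fin d)), MeasurableSet C → Bornology.IsBounded C →
      0 < genZ C (ENNReal.ofReal lam • volume) ∧ ∀ B ⊆ C, MeasurableSet B →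
        Real.exp (-(α * (volume (C \ B)).toReal)) * genZ B (ENNReal.ofReal lam • volume) ≤
          genZ C (ENNReal.ofReal lam • volume) := by
    intro C hCm hCb
    have h := genZ_pos_and_ratio (M := ENNReal.ofReal lam • volume) (β := Real.exp (α * V))
      (v := lam * V) (by rw [← mul_assoc, hβlam]) (fun x => hfinite _ isBounded_ball)
      (fun x => by rw [hreal, Measure.addHaar_ball_center, hV]) hCm (hfinite C hCb)
      (hCb.isCompact_closure.totallyBounded.subset subset_closure)
    simpa only [hreal, ← mul_assoc, hβlam] using h
  refine ⟨fun B hBm hBb => (key B hBm hBb).1, fun A B hAm hBm hAb hBb => ⟨?_, Real.exp_pos _⟩⟩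
  rw [le_div_iff₀ (key B hBm hBb).1, ← Set.union_sdiff_right]
  exact (key _ (hAm.union hBm) (hAb.union hBb)).2 B Set.subset_union_right hBm
end

section
/- Monotonicity of Z in space: if M ∈ 𝓜^sh and A ⊆ B are Borel sets of finite unit partition number, then Z(A, M) ≥ Z(B, M); in particular, if Z(B, M) > 0 then Z(A, M) > 0. -/
open MeasureTheory Metric

/-- The `n`-tuples in `B` whose entries are pairwise at distance at least one. -/
def hardCoreSet {X : Type*} [MetricSpace X] (n : ℕ) (B : Set X) : Set (Fin n → X) :=
  {x | (∀ i, x i ∈ B) ∧ ∀ i j, i ≠ j → 1 ≤ dist (x i) (x j)}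

/-- The pairs `(x, y)` with `x ∈ C` and `y` a hard-core tuple in `A` off the unit ball at `x`. -/
def hardCoreExtension {X : Type*} [MetricSpace X] (n : ℕ) (A C : Set X) :
    Set (X × (Fin n → X)) :=
  {p | p.1 ∈ C ∧ p.2 ∈ hardCoreSet n (A \ ball p.1 1)}

section HardCore

variable {X : Type*} [MetricSpace X]

lemma hardCoreSet_mono {n : ℕ} {A B : Set X} (h : A ⊆ B) : hardCoreSet n A ⊆ hardCoreSet n B :=
  fun _ hx => ⟨fun i => h (hx.1 i), hx.2⟩

lemma hardCoreSet_subset_pi (n : ℕ) (B : Set X) :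
    hardCoreSet n B ⊆ Set.univ.pi fun _ : Fin n => B :=
  fun _ hx i _ => hx.1 i

lemma hardCoreSet_eq_empty {m n : ℕ} {B : Set X} {D : Fin m → Set X}
    (hD : ∀ i, ∀ x ∈ D i, ∀ y ∈ D i, dist x y < 1) (hB : B ⊆ ⋃ i, D i) (hmn : m < n) :
    hardCoreSet n B = ∅ := by
  refine Set.eq_empty_of_forall_notMem fun x hx => ?_
  have hc : ∀ i, ∃ k, x i ∈ D k := fun i => Set.mem_iUnion.1 (hB (hx.1 i))
  choose f hf using hc
  obtain ⟨i, j, hij, hfij⟩ := Fintype.exists_ne_map_eq_of_card_lt f (by simpa using hmn)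
  exact absurd (hx.2 i j hij) (not_le.2 (hD (f i) _ (hf i) _ (hfij ▸ hf j)))

/-- A hard-core tuple in `A ∪ C` has at most one entry in `C`, if `C` is small. -/
lemma hardCoreSet_succ_union (n : ℕ) {A C : Set X}
    (hC : ∀ x ∈ C, ∀ y ∈ C, dist x y < 1) :
    hardCoreSet (n + 1) (A ∪ C) = hardCoreSet (n + 1) A ∪
      ⋃ i : Fin (n + 1), {z | (z i, fun j => z (i.succAbove j)) ∈ hardCoreExtension n A C} := by
  ext z
  simp only [hardCoreSet, hardCoreExtension, Set.mem_union, Set.mem_ofPred_eq, Set.mem_iUnion,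
    Set.mem_sdiff, mem_ball, not_lt]
  constructor
  · rintro ⟨hz, hd⟩
    by_cases h : ∃ i, z i ∈ C
    · obtain ⟨i, hi⟩ := h
      refine Or.inr ⟨i, hi, fun j => ⟨?_, hd _ _ (Fin.succAbove_ne i j)⟩, fun j k hjk =>
        hd _ _ (fun h => hjk (Fin.succAbove_right_injective h))⟩
      refine (hz _).resolve_right fun hj => ?_
      exact absurd (hd _ _ (Fin.succAbove_ne i j)) (not_le.2 (hC _ hj _ hi))
    · push Not at h
      exact Or.inl ⟨fun i => (hz i).resolve_right (h i), hd⟩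
  · rintro (⟨hz, hd⟩ | ⟨i, hi, hz, hd⟩)
    · exact ⟨fun i => Or.inl (hz i), hd⟩
    · refine ⟨i.forall_iff_succAbove.2 ⟨Or.inr hi, fun j => Or.inl (hz j).1⟩, ?_⟩
      refine i.forall_iff_succAbove.2 ⟨?_, fun j => ?_⟩
      · refine i.forall_iff_succAbove.2 ⟨fun h => absurd rfl h, fun k _ => ?_⟩
        rw [dist_comm]
        exact (hz k).2
      · refine i.forall_iff_succAbove.2 ⟨fun _ => (hz j).2, fun k hk => hd j k ?_⟩
        rintro rfl
        exact hk rfl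

lemma measure_hardCoreSet_ne_top [MeasurableSpace X] {M : Measure X} [SigmaFinite M] (n : ℕ)
    {B : Set X} (hB : M B ≠ ⊤) :
    (Measure.pi fun _ : Fin n => M) (hardCoreSet n B) ≠ ⊤ := by
  refine ne_top_of_le_ne_top ?_ (measure_mono (hardCoreSet_subset_pi n B))
  rw [Measure.pi_pi]
  exact ENNReal.prod_ne_top fun _ _ => hB

lemma measure_hardCoreExtension_ne_top [MeasurableSpace X] {M : Measure X} [SigmaFinite M]
    (n : ℕ) {A C : Set X} (hA : M A ≠ ⊤) (hC : M C ≠ ⊤) :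
    (M.prod (Measure.pi fun _ : Fin n => M)) (hardCoreExtension n A C) ≠ ⊤ := by
  have h : hardCoreExtension n A C ⊆ C ×ˢ hardCoreSet n A := fun p hp =>
    ⟨hp.1, hardCoreSet_mono Set.sdiff_subset hp.2⟩
  refine ne_top_of_le_ne_top ?_ (measure_mono h)
  rw [Measure.prod_prod]
  exact ENNReal.mul_ne_top hC (measure_hardCoreSet_ne_top n hA)

variable [SecondCountableTopology X] [MeasurableSpace X] [BorelSpace X]

lemma measurableSet_hardCoreExtension (n : ℕ) {A C : Set X} (hA : MeasurableSet A)
    (hC : MeasurableSet C) : MeasurableSet (hardCoreExtension n A C) := by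
  have hy : ∀ i : Fin n, Measurable fun p : X × (Fin n → X) => p.2 i := fun i =>
    (measurable_pi_apply i).comp measurable_snd
  have h : hardCoreExtension n A C = Prod.fst ⁻¹' C ∩
      ((⋂ i, (fun p : X × (Fin n → X) => p.2 i) ⁻¹' A ∩ {p | 1 ≤ dist (p.2 i) p.1}) ∩
        ⋂ i, ⋂ j, ⋂ _ : i ≠ j, {p : X × (Fin n → X) | 1 ≤ dist (p.2 i) (p.2 j)}) := by
    ext p
    simp [hardCoreExtension, hardCoreSet]
  rw [h]
  refine (measurable_fst hC).inter (.inter (.iInter fun i => ?_) ?_)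
  · exact (hy i hA).inter (measurableSet_le measurable_const ((hy i).dist measurable_fst))
  · exact .iInter fun i => .iInter fun j => .iInter fun _ =>
      measurableSet_le measurable_const ((hy i).dist (hy j))

lemma measurableSet_hardCoreSet (n : ℕ) {B : Set X} (hB : MeasurableSet B) :
    MeasurableSet (hardCoreSet n B) := by
  have h : hardCoreSet n B = (⋂ i, (fun x => x i) ⁻¹' B) ∩
      ⋂ i, ⋂ j, ⋂ _ : i ≠ j, {x | 1 ≤ dist (x i) (x j)} := by
    ext x
    simp [hardCoreSet]
  rw [h]
  exact .inter (.iInter fun i => measurable_pi_apply i hB) <|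
    .iInter fun i => .iInter fun j => .iInter fun _ =>
      measurableSet_le measurable_const ((measurable_pi_apply i).dist (measurable_pi_apply j))

variable {M : Measure X}

lemma genZ_eq_tsum {B : Set X} (hB : MeasurableSet B) :
    genZ B M = ∑' n : ℕ, ((-1 : ℝ) ^ n / n.factorial) *
      (Measure.pi fun _ : Fin n => M).real (hardCoreSet n B) := by
  unfold genZ
  congr! 3 with n
  rw [← integral_indicator (.univ_pi fun _ => hB),
    ← integral_indicator_one (measurableSet_hardCoreSet n hB)]
  congr 1 with x
  classical
  simp only [hardCore, hardCoreSet, Set.indicator_apply, Set.mem_univ_pi, Set.mem_ofPred_eq,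
    Pi.one_apply]
  split_ifs <;> tauto

lemma genZ_eq_sum {B : Set X} (hB : MeasurableSet B) {N : ℕ}
    (hN : ∀ n, N ≤ n → hardCoreSet n B = ∅) :
    genZ B M = ∑ n ∈ Finset.range N, ((-1 : ℝ) ^ n / n.factorial) *
      (Measure.pi fun _ : Fin n => M).real (hardCoreSet n B) := by
  rw [genZ_eq_tsum hB]
  refine tsum_eq_sum fun n hn => ?_
  rw [hN n (by simpa using hn)]
  simp

variable [SigmaFinite M]

lemma measureReal_hardCoreSet_succ_union (n : ℕ) {A C : Set X} (hA : MeasurableSet A)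
    (hCm : MeasurableSet C) (hAC : Disjoint A C) (hC : ∀ x ∈ C, ∀ y ∈ C, dist x y < 1)
    (hfin : M (A ∪ C) ≠ ⊤) :
    (Measure.pi fun _ : Fin (n + 1) => M).real (hardCoreSet (n + 1) (A ∪ C)) =
      (Measure.pi fun _ : Fin (n + 1) => M).real (hardCoreSet (n + 1) A) +
      (n + 1) * (M.prod (Measure.pi fun _ : Fin n => M)).real (hardCoreExtension n A C) := by
  let F : Fin (n + 1) → Set (Fin (n + 1) → X) := fun i =>
    {z | (z i, fun j => z (i.succAbove j)) ∈ hardCoreExtension n A C}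
  have hmp := fun i : Fin (n + 1) => measurePreserving_piFinSuccAbove (fun _ => M) i
  have hE := measurableSet_hardCoreExtension n hA hCm
  have hF : ∀ i, MeasurableSet (F i) := fun i => (hmp i).measurable hE
  have hFr : ∀ i, (Measure.pi fun _ : Fin (n + 1) => M).real (F i) =
      (M.prod (Measure.pi fun _ : Fin n => M)).real (hardCoreExtension n A C) := fun i =>
    (hmp i).measureReal_preimage hE.nullMeasurableSet
  have heq := hardCoreSet_succ_union n (A := A) hC
  have htop := measure_hardCoreSet_ne_top (n + 1) hfin
  have hFsub : (⋃ i, F i) ⊆ hardCoreSet (n + 1) (A ∪ C) := heq ▸ Set.subset_union_right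
  have hFtop : ∀ i, (Measure.pi fun _ : Fin (n + 1) => M) (F i) ≠ ⊤ := fun i =>
    ne_top_of_le_ne_top htop (measure_mono ((Set.subset_iUnion F i).trans hFsub))
  have hdisj : Disjoint (hardCoreSet (n + 1) A) (⋃ i, F i) := by
    refine Set.disjoint_left.2 fun z hz hz' => ?_
    obtain ⟨i, hi⟩ := Set.mem_iUnion.1 hz'
    exact Set.disjoint_left.1 hAC (hz.1 i) hi.1
  have hpair : Pairwise (Function.onFun Disjoint F) := by
    intro i j hij
    refine Set.disjoint_left.2 fun z hi hj => ?_
    obtain ⟨k, rfl⟩ := Fin.exists_succAbove_eq hij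
    exact Set.disjoint_left.1 hAC (hj.2.1 k).1 hi.1
  rw [heq, measureReal_union hdisj (.iUnion hF)
    (ne_top_of_le_ne_top htop (measure_mono (hardCoreSet_mono Set.subset_union_left)))
    (ne_top_of_le_ne_top htop (measure_mono hFsub)),
    measureReal_iUnion_fintype hpair hF hFtop, Finset.sum_congr rfl fun i _ => hFr i]
  simp

lemma measureReal_hardCoreExtension (n : ℕ) {A C : Set X} (hA : MeasurableSet A)
    (hC : MeasurableSet C) (hAfin : M A ≠ ⊤) (hCfin : M C ≠ ⊤) :
    (M.prod (Measure.pi fun _ : Fin n => M)).real (hardCoreExtension n A C) =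
      ∫ x, (Measure.pi fun _ : Fin n => M).real (Prod.mk x ⁻¹' hardCoreExtension n A C) ∂M := by
  have hE := measurableSet_hardCoreExtension n hA hC
  have hfin := measure_hardCoreExtension_ne_top n hAfin hCfin
  simp only [measureReal_def]
  rw [integral_toReal (measurable_measure_prodMk_left hE).aemeasurable
    (Measure.ae_measure_lt_top hE hfin), Measure.prod_apply hE]

/-- Adjoining to `A` a disjoint set `C` which holds at most one point of a hard-core tuple does
not increase the generating function. -/
lemma genZ_union_le {A C : Set X} (hA : MeasurableSet A) (hCm : MeasurableSet C)
    (hAC : Disjoint A C) (hC : ∀ x ∈ C, ∀ y ∈ C, dist x y < 1) (hfin : M (A ∪ C) ≠ ⊤) {N : ℕ}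
    (hN : ∀ n, N ≤ n → hardCoreSet n (A ∪ C) = ∅)
    (hnonneg : ∀ x ∈ C, 0 ≤ genZ (A \ ball x 1) M) :
    genZ (A ∪ C) M ≤ genZ A M := by
  have hNA : ∀ n, N ≤ n → hardCoreSet n A = ∅ := fun n hn =>
    Set.subset_eq_empty (hardCoreSet_mono Set.subset_union_left) (hN n hn)
  have hAfin : M A ≠ ⊤ := ne_top_of_le_ne_top hfin (measure_mono Set.subset_union_left)
  have hCfin : M C ≠ ⊤ := ne_top_of_le_ne_top hfin (measure_mono Set.subset_union_right)
  let J : ℕ → X → ℝ := fun n x =>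
    (Measure.pi fun _ : Fin n => M).real (Prod.mk x ⁻¹' hardCoreExtension n A C)
  have hJ : ∀ n, Integrable (J n) M := fun n =>
    Measure.integrable_measure_prodMk_left (measurableSet_hardCoreExtension n hA hCm)
      (measure_hardCoreExtension_ne_top n hAfin hCfin)
  have hsum : ∀ x, 0 ≤ ∑ n ∈ Finset.range N, ((-1 : ℝ) ^ n / n.factorial) * J n x := by
    intro x
    by_cases hx : x ∈ C
    · have hJx : ∀ n, J n x = (Measure.pi fun _ : Fin n => M).real
          (hardCoreSet n (A \ ball x 1)) := fun n => by
        simp [J, hardCoreExtension, hx]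
      simp only [hJx]
      rw [← genZ_eq_sum (hA.diff measurableSet_ball) fun n hn =>
        Set.subset_eq_empty (hardCoreSet_mono Set.sdiff_subset) (hNA n hn)]
      exact hnonneg x hx
    · have hJx : ∀ n, J n x = 0 := fun n => by simp [J, hardCoreExtension, hx]
      simp [hJx]
  have hint : 0 ≤ ∑ n ∈ Finset.range N, ((-1 : ℝ) ^ n / n.factorial) * ∫ x, J n x ∂M := by
    simp_rw [← integral_const_mul]
    rw [← integral_finsetSum _ fun n _ => (hJ n).const_mul _]
    exact integral_nonneg hsum
  rw [genZ_eq_sum (N := N + 1) (hA.union hCm) fun n hn => hN n (by omega),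
    genZ_eq_sum (N := N + 1) hA fun n hn => hNA n (by omega),
    Finset.sum_range_succ', Finset.sum_range_succ' (fun n => _ * Measure.real _ (hardCoreSet n A))]
  have hzero : hardCoreSet 0 (A ∪ C) = hardCoreSet 0 A := by
    simp [hardCoreSet]
  have hterm : ∀ n : ℕ, ((-1 : ℝ) ^ (n + 1) / (n + 1).factorial) *
      (Measure.pi fun _ : Fin (n + 1) => M).real (hardCoreSet (n + 1) (A ∪ C)) =
      ((-1 : ℝ) ^ (n + 1) / (n + 1).factorial) *
      (Measure.pi fun _ : Fin (n + 1) => M).real (hardCoreSet (n + 1) A) -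
      ((-1 : ℝ) ^ n / n.factorial) * ∫ x, J n x ∂M := fun n => by
    rw [measureReal_hardCoreSet_succ_union n hA hCm hAC hC hfin,
      measureReal_hardCoreExtension n hA hCm hAfin hCfin, Nat.factorial_succ]
    have : (n.factorial : ℝ) ≠ 0 := by positivity
    push_cast
    field_simp
    ring
  rw [Finset.sum_congr rfl fun n _ => hterm n, Finset.sum_sub_distrib, hzero]
  linarith

end HardCore

/-- Monotonicity of `Z` in space: if `M ∈ 𝓜^sh` and `A ⊆ B` are Borel sets of finite
unit partition number, then `Z(A, M) ≥ Z(B, M)`; in particular `Z(B, M) > 0` implies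
`Z(A, M) > 0`. -/
theorem stmt17 {X : Type*} [MetricSpace X] [CompleteSpace X]
    [TopologicalSpace.SeparableSpace X] [MeasurableSpace X] [BorelSpace X]
    (M : Measure X) (hM : ∀ s : Set X, Bornology.IsBounded s → M s < ⊤)
    (hsh : ∀ B : Set X, MeasurableSet B → Bornology.IsBounded B → 0 ≤ genZ B M)
    (A B : Set X) (hAm : MeasurableSet A) (hBm : MeasurableSet B)
    (hAk : kappa A < ⊤) (hBk : kappa B < ⊤) (hAB : A ⊆ B) :
    genZ B M ≤ genZ A M ∧ (0 < genZ B M → 0 < genZ A M) := by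
  suffices h : genZ B M ≤ genZ A M from ⟨h, fun h0 => h0.trans_le h⟩
  have : SecondCountableTopology X := UniformSpace.secondCountable_of_separable X
  have : IsLocallyFiniteMeasure M :=
    ⟨fun x => ⟨ball x 1, ball_mem_nhds x one_pos, hM _ isBounded_ball⟩⟩
  obtain ⟨_, ⟨m, -, D, hDm, hDdiam, -, hDB⟩, -⟩ := sInf_lt_iff.1 hBk
  have hDdist : ∀ i, ∀ x ∈ D i, ∀ y ∈ D i, dist x y < 1 := by
    intro i x hx y hy
    have h := (edist_le_ediam_of_mem hx hy).trans_lt (hDdiam i)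
    rw [edist_dist] at h
    simpa using h
  have hBbdd : Bornology.IsBounded B := by
    rw [hDB, Bornology.isBounded_iUnion]
    exact fun i => isBounded_iff.2 ⟨1, fun x hx y hy => (hDdist i x hx y hy).le⟩
  have key : ∀ s : Finset (Fin m), genZ (A ∪ (B ∩ ⋃ i ∈ s, D i)) M ≤ genZ A M := by
    intro s
    induction s using Finset.induction_on with
    | empty => simp
    | insert i s _ ih =>
      set A' := A ∪ (B ∩ ⋃ i ∈ s, D i) with hA'
      have hA'm : MeasurableSet A' :=
        hAm.union (hBm.inter (Finset.measurableSet_biUnion s fun i _ => hDm i))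
      have hA'B : A' ⊆ B := Set.union_subset hAB Set.inter_subset_left
      have heq : A ∪ (B ∩ ⋃ j ∈ insert i s, D j) = A' ∪ (B ∩ D i) \ A' := by
        rw [Set.union_sdiff_self, Finset.set_biUnion_insert, Set.inter_union_distrib_left, hA',
          Set.union_assoc, Set.union_comm (B ∩ D i)]
      have hsub : A' ∪ (B ∩ D i) \ A' ⊆ B :=
        Set.union_subset hA'B (Set.sdiff_subset.trans Set.inter_subset_left)
      rw [heq]
      refine (genZ_union_le (N := m + 1) hA'm ((hBm.inter (hDm i)).diff hA'm)
        Set.disjoint_sdiff_right (fun x hx y hy => hDdist i x hx.1.2 y hy.1.2)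
        (hM _ (hBbdd.subset hsub)).ne
        (fun n hn => hardCoreSet_eq_empty hDdist (hsub.trans hDB.subset) hn)
        fun x _ => hsh _ (hA'm.diff measurableSet_ball)
          (hBbdd.subset (Set.sdiff_subset.trans hA'B))).trans ih
  have h := key Finset.univ
  simpa [← hDB, Set.union_eq_right.2 hAB] using h
end
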